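/- Let r ≥ 1 and let F be a finite bipartite r-degenerate graph. Then there exists a constant C depending only on F such that for all n, ex(n, F) ≤ C · n^{2 - 1/(4r)}. -/

import Mathlib

/-- `F` is contained in `G` as a subgraph, i.e. there is an injective graph
homomorphism from `F` to `G`. -/
def ContainsCopy {α : Type*} {β : Type*} (F : SimpleGraph α) (G : SimpleGraph β) : Prop :=
  ∃ f : α → β, Function.Injective f ∧ ∀ ⦃a b⦄, F.Adj a b → G.Adj (f a) (f b)

/-- A graph is `r`-degenerate if every nonempty subgraph has a vertex of degree
at most `r`. -/
def Degenerate (r : ℕ) {V : Type*} (F : SimpleGraph V) : Prop :=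
  ∀ H : F.Subgraph, H.verts.Nonempty → ∃ v ∈ H.verts, (H.neighborSet v).ncard ≤ r

open Finset in
/-- The common neighbourhood of a family of vertices. -/
noncomputable def commonNbrs {ι W : Type*} [Fintype W] (G : SimpleGraph W) (t : ι → W) :
    Finset W :=
  open Classical in univ.filter fun v => ∀ i, G.Adj (t i) v

section
open Finset

variable {ι κ W : Type*} [Fintype W] {G : SimpleGraph W}

lemma mem_commonNbrs {t : ι → W} {v : W} : v ∈ commonNbrs G t ↔ ∀ i, G.Adj (t i) v := by
  simp [commonNbrs]

lemma forall_mem_commonNbrs_comm {s : ι → W} {t : κ → W} :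
    (∀ j, t j ∈ commonNbrs G s) ↔ ∀ i, s i ∈ commonNbrs G t := by
  simp only [mem_commonNbrs]
  exact ⟨fun h i j => (h j i).symm, fun h i j => (h j i).symm⟩

lemma card_filter_forall_mem [Fintype ι] [DecidableEq ι] (s : Finset W)
    [DecidablePred fun t : ι → W => ∀ i, t i ∈ s] :
    #{t : ι → W | ∀ i, t i ∈ s} = #s ^ Fintype.card ι := by
  have h : ({t : ι → W | ∀ i, t i ∈ s} : Finset _) = Fintype.piFinset fun _ => s := by
    ext t
    simp
  simp [h]

open Classical in
lemma sum_card_commonNbrs [Fintype ι] [DecidableEq ι] :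
    ∑ t : ι → W, #(commonNbrs G t) = ∑ v, G.degree v ^ Fintype.card ι := by
  have h := sum_card_bipartiteAbove_eq_sum_card_bipartiteBelow
    (s := (univ : Finset (ι → W))) (t := (univ : Finset W)) (fun t v => ∀ i, G.Adj (t i) v)
  refine Eq.trans (sum_congr rfl fun t _ => ?_) (h.trans (sum_congr rfl fun v _ => ?_))
  · congr 1
    ext v
    simp [mem_commonNbrs, bipartiteAbove]
  · rw [← G.card_neighborFinset_eq_degree, ← card_filter_forall_mem (ι := ι)]
    congr 1
    ext t
    simp [bipartiteBelow, G.adj_comm]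

open Classical in
/-- The number of mutually adjacent pairs of `(k + 1)`-tuples is at least what the edge density
predicts. -/
lemma sum_degree_pow_le (G : SimpleGraph W) (k : ℕ) :
    (∑ v, G.degree v) ^ ((k + 1) * (k + 1)) ≤
      Fintype.card W ^ (2 * (k * (k + 1))) *
        ∑ t : Fin (k + 1) → W, #(commonNbrs G t) ^ (k + 1) := by
  have h₁ := pow_sum_le_card_mul_sum_pow (s := univ) (f := fun v => G.degree v)
    (fun _ _ => Nat.zero_le _) k
  have h₂ := pow_sum_le_card_mul_sum_pow (s := univ)
    (f := fun t : Fin (k + 1) → W => #(commonNbrs G t)) (fun _ _ => Nat.zero_le _) k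
  rw [sum_card_commonNbrs] at h₂
  simp only [card_univ, Fintype.card_fin, Fintype.card_pi, prod_const, Nat.cast_id] at h₁ h₂
  calc (∑ v, G.degree v) ^ ((k + 1) * (k + 1))
      = ((∑ v, G.degree v) ^ (k + 1)) ^ (k + 1) := by rw [pow_mul]
    _ ≤ (Fintype.card W ^ k * ∑ v, G.degree v ^ (k + 1)) ^ (k + 1) := by gcongr
    _ = Fintype.card W ^ (k * (k + 1)) * (∑ v, G.degree v ^ (k + 1)) ^ (k + 1) := by
        rw [mul_pow, pow_mul]
    _ ≤ Fintype.card W ^ (k * (k + 1)) * ((Fintype.card W ^ (k + 1)) ^ k *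
          ∑ t : Fin (k + 1) → W, #(commonNbrs G t) ^ (k + 1)) := by gcongr
    _ = _ := by ring

open Classical in
/-- If more pairs of `k`-tuples are mutually adjacent than the stated bound, then some such pair
spans common neighbourhoods in which every `r`-tuple of one side has at least `h` common
neighbours in the other side. -/
lemma exists_pair_of_lt_sum (G : SimpleGraph W) (k r h : ℕ)
    (hlt : 2 * (Fintype.card W ^ (k + r) * h ^ k) <
      ∑ t : Fin k → W, #(commonNbrs G t) ^ k) :
    ∃ t s : Fin k → W, (∀ i, s i ∈ commonNbrs G t) ∧
      (∀ u : Fin r → W, (∀ i, u i ∈ commonNbrs G t) →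
        h ≤ #(commonNbrs G u ∩ commonNbrs G s)) ∧
      (∀ u : Fin r → W, (∀ i, u i ∈ commonNbrs G s) →
        h ≤ #(commonNbrs G u ∩ commonNbrs G t)) := by
  by_contra! hbad
  let P : Finset ((Fin k → W) × (Fin k → W)) := {p | ∀ i, p.2 i ∈ commonNbrs G p.1}
  let Q : Finset (((Fin k → W) × (Fin r → W)) × (Fin k → W)) :=
    {q | #(commonNbrs G q.1.2 ∩ commonNbrs G q.1.1) < h ∧
      ∀ i, q.2 i ∈ commonNbrs G q.1.2 ∩ commonNbrs G q.1.1}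
  have hP : #P = ∑ t : Fin k → W, #(commonNbrs G t) ^ k := by
    rw [card_filter, ← univ_product_univ, sum_product]
    refine sum_congr rfl fun t _ => ?_
    rw [← card_filter]
    simpa using card_filter_forall_mem (ι := Fin k) (commonNbrs G t)
  have hQ : #Q ≤ Fintype.card W ^ (k + r) * h ^ k := by
    rw [card_filter, ← univ_product_univ, sum_product]
    refine (sum_le_card_nsmul _ _ (h ^ k) fun p _ => ?_).trans_eq ?_
    · rw [← card_filter]
      by_cases hp : #(commonNbrs G p.2 ∩ commonNbrs G p.1) < h
      · simp only [hp, true_and]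
        refine (card_filter_forall_mem (ι := Fin k) _).trans_le ?_
        rw [Fintype.card_fin]
        exact Nat.pow_le_pow_left hp.le k
      · simp [hp]
    · simp [pow_add]
  have hPQ : P ⊆ Q.image (fun q => (q.2, q.1.1)) ∪ Q.image (fun q => (q.1.1, q.2)) := by
    rintro ⟨t, s⟩ hp
    have hts : ∀ i, s i ∈ commonNbrs G t := by simpa [P] using hp
    have hst : ∀ i, t i ∈ commonNbrs G s := forall_mem_commonNbrs_comm.1 hts
    rw [mem_union, mem_image, mem_image]
    by_cases hu : ∃ u : Fin r → W, (∀ i, u i ∈ commonNbrs G t) ∧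
        #(commonNbrs G u ∩ commonNbrs G s) < h
    · obtain ⟨u, hut, hu⟩ := hu
      refine Or.inl ⟨((s, u), t), ?_, rfl⟩
      simp only [Q, mem_filter, mem_univ, true_and, mem_inter]
      exact ⟨hu, fun i => ⟨forall_mem_commonNbrs_comm.1 hut i, hst i⟩⟩
    · push Not at hu
      obtain ⟨u, hus, hu⟩ := hbad t s hts hu
      refine Or.inr ⟨((t, u), s), ?_, rfl⟩
      simp only [Q, mem_filter, mem_univ, true_and, mem_inter]
      exact ⟨hu, fun i => ⟨forall_mem_commonNbrs_comm.1 hus i, hts i⟩⟩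
  have := (card_le_card hPQ).trans (card_union_le _ _)
  have h₁ := card_image_le (s := Q) (f := fun q => (q.2, q.1.1))
  have h₂ := card_image_le (s := Q) (f := fun q => (q.1.1, q.2))
  omega

lemma exists_tuple_covering {α : Type*} {r : ℕ} {A : Finset α} (hA : A.Nonempty) {s : Finset α}
    (hs : s ⊆ A) (hr : #s ≤ r) :
    ∃ u : Fin r → α, (∀ i, u i ∈ A) ∧ ∀ x ∈ s, ∃ i, u i = x := by
  obtain ⟨a, ha⟩ := hA
  refine ⟨fun i => if hi : (i : ℕ) < #s then s.equivFin.symm ⟨i, hi⟩ else a, fun i => ?_,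
    fun x hx => ⟨⟨s.equivFin ⟨x, hx⟩, (s.equivFin ⟨x, hx⟩).2.trans_le hr⟩, by simp⟩⟩
  dsimp only
  split_ifs with hi
  · exact hs (s.equivFin.symm ⟨i, hi⟩).2
  · exact ha

open Classical in
/-- A 2-coloured `r`-degenerate graph embeds vertex by vertex into a pair of sets such that every
`r`-tuple in either set has many common neighbours in the other one. -/
lemma containsCopy_of_common_nbrs {V : Type*} [Fintype V] {r : ℕ} {F : SimpleGraph V}
    (c : F.Coloring (Fin 2)) (hdeg : Degenerate r F) (A : Fin 2 → Finset W)
    (hne : ∀ x, (A x).Nonempty)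
    (hA : ∀ x y, x ≠ y → ∀ u : Fin r → W, (∀ i, u i ∈ A x) →
      Fintype.card V ≤ #(commonNbrs G u ∩ A y)) :
    ContainsCopy F G := by
  suffices H : ∀ S : Finset V, ∃ f : V → W, Set.InjOn f S ∧ (∀ v ∈ S, f v ∈ A (c v)) ∧
      ∀ a ∈ S, ∀ b ∈ S, F.Adj a b → G.Adj (f a) (f b) by
    obtain ⟨f, hinj, -, hadj⟩ := H univ
    exact ⟨f, by simpa using hinj, fun a b hab => hadj a (mem_univ _) b (mem_univ _) hab⟩
  intro S
  induction hn : #S generalizing S with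
  | zero =>
    rw [card_eq_zero] at hn
    subst hn
    exact ⟨fun _ => (hne 0).choose, by simp⟩
  | succ n ih =>
    have hS : S.Nonempty := card_pos.1 (by omega)
    obtain ⟨v, hv, hvr⟩ := hdeg ((⊤ : F.Subgraph).induce S) (by simpa using hS)
    replace hv : v ∈ S := by simpa using hv
    obtain ⟨f, hinj, hmem, hadj⟩ := ih (S.erase v) (by rw [card_erase_of_mem hv]; omega)
    let N : Finset V := {w ∈ S | F.Adj v w}
    have hN : #N ≤ r := by
      convert hvr
      rw [← Set.ncard_coe_finset]
      congr 1
      ext w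
      simp [N, hv]
    have hNS : ∀ w ∈ N, w ∈ S.erase v ∧ F.Adj v w := fun w hw => by
      obtain ⟨h₁, h₂⟩ := mem_filter.1 hw
      exact ⟨mem_erase.2 ⟨h₂.ne', h₁⟩, h₂⟩
    obtain ⟨x, hx⟩ : ∃ x, x ≠ c v := exists_ne _
    have hNx : N.image f ⊆ A x := by
      intro y hy
      obtain ⟨w, hw, rfl⟩ := mem_image.1 hy
      have : c w = x := by
        have := c.valid (hNS w hw).2
        omega
      exact this ▸ hmem w (hNS w hw).1
    obtain ⟨u, huA, hu⟩ := exists_tuple_covering (hne x) hNx (card_image_le.trans hN)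
    have hlt : #((S.erase v).image f) < #(commonNbrs G u ∩ A (c v)) := by
      refine lt_of_lt_of_le ?_ (hA x (c v) hx u huA)
      exact card_image_le.trans_lt ((card_erase_lt_of_mem hv).trans_le (card_le_univ S))
    obtain ⟨y, hy, hyf⟩ := exists_mem_notMem_of_card_lt_card hlt
    obtain ⟨hyu, hyA⟩ := mem_inter.1 hy
    have hyN : ∀ w ∈ S.erase v, F.Adj v w → G.Adj (f w) y := fun w hw hvw => by
      obtain ⟨i, hi⟩ := hu (f w)
        (mem_image_of_mem f (mem_filter.2 ⟨(mem_erase.1 hw).2, hvw⟩))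
      exact hi ▸ mem_commonNbrs.1 hyu i
    have hyne : ∀ w ∈ S.erase v, f w ≠ y := fun w hw h => hyf (h ▸ mem_image_of_mem f hw)
    refine ⟨Function.update f v y, ?_, ?_, ?_⟩
    · intro a ha b hb hab
      by_cases hav : a = v <;> by_cases hbv : b = v
      · rw [hav, hbv]
      · subst hav
        rw [Function.update_self, Function.update_of_ne hbv] at hab
        exact absurd hab.symm (hyne b (mem_erase.2 ⟨hbv, hb⟩))
      · subst hbv
        rw [Function.update_self, Function.update_of_ne hav] at hab
        exact absurd hab (hyne a (mem_erase.2 ⟨hav, ha⟩))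
      · rw [Function.update_of_ne hav, Function.update_of_ne hbv] at hab
        exact hinj (mem_erase.2 ⟨hav, ha⟩) (mem_erase.2 ⟨hbv, hb⟩) hab
    · intro a ha
      by_cases hav : a = v
      · subst hav
        simpa using hyA
      · rw [Function.update_of_ne hav]
        exact hmem a (mem_erase.2 ⟨hav, ha⟩)
    · intro a ha b hb hab
      by_cases hav : a = v <;> by_cases hbv : b = v
      · exact absurd (hav.trans hbv.symm) hab.ne
      · subst hav
        rw [Function.update_self, Function.update_of_ne hbv]
        exact (hyN b (mem_erase.2 ⟨hbv, hb⟩) hab).symm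
      · subst hbv
        rw [Function.update_self, Function.update_of_ne hav]
        exact hyN a (mem_erase.2 ⟨hav, ha⟩) hab.symm
      · rw [Function.update_of_ne hav, Function.update_of_ne hbv]
        exact hadj a (mem_erase.2 ⟨hav, ha⟩) b (mem_erase.2 ⟨hbv, hb⟩) hab

open Classical in
lemma sum_degree_pow_le_of_not_containsCopy {V : Type*} [Fintype V] {r : ℕ} (hr : 1 ≤ r)
    {F : SimpleGraph V} (hbip : F.Colorable 2) (hdeg : Degenerate r F)
    (hG : ¬ ContainsCopy F G) :
    (∑ v, G.degree v) ^ (4 * r ^ 2) ≤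
      2 * Fintype.card V ^ (2 * r) * Fintype.card W ^ (8 * r ^ 2 - r) := by
  obtain ⟨c⟩ := hbip
  rcases isEmpty_or_nonempty V with hV | hV
  · exact absurd ⟨isEmptyElim, fun a => isEmptyElim a, fun a => isEmptyElim a⟩ hG
  have hle : ∑ t : Fin (2 * r) → W, #(commonNbrs G t) ^ (2 * r) ≤
      2 * (Fintype.card W ^ (2 * r + r) * Fintype.card V ^ (2 * r)) := by
    by_contra! hlt
    obtain ⟨t, s, hst, ht, hs⟩ := exists_pair_of_lt_sum G (2 * r) r (Fintype.card V) hlt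
    have h0 : (commonNbrs G t).Nonempty := ⟨s ⟨0, by omega⟩, hst _⟩
    have h1 : (commonNbrs G s).Nonempty := ⟨t ⟨0, by omega⟩, forall_mem_commonNbrs_comm.1 hst _⟩
    refine hG (containsCopy_of_common_nbrs c hdeg ![commonNbrs G t, commonNbrs G s] ?_ ?_)
    · rw [Fin.forall_fin_two]
      exact ⟨h0, h1⟩
    · simp only [Fin.forall_fin_two]
      exact ⟨⟨fun h => absurd rfl h, fun _ => ht⟩, fun _ => hs, fun h => absurd rfl h⟩
  obtain ⟨k, hk⟩ : ∃ k, 2 * r = k + 1 := ⟨2 * r - 1, by omega⟩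
  have key := sum_degree_pow_le G k
  rw [← hk] at key
  calc (∑ v, G.degree v) ^ (4 * r ^ 2) = (∑ v, G.degree v) ^ (2 * r * (2 * r)) := by
        congr 1; ring
    _ ≤ _ := key.trans (Nat.mul_le_mul_left _ hle)
    _ = 2 * Fintype.card V ^ (2 * r) *
          Fintype.card W ^ (2 * (k * (2 * r)) + (2 * r + r)) := by ring
    _ = _ := by
        congr 2
        obtain rfl : k = 2 * r - 1 := by omega
        obtain ⟨m, rfl⟩ : ∃ m, r = m + 1 := ⟨r - 1, by omega⟩
        have : 2 * (m + 1) - 1 = 2 * m + 1 := by omega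
        rw [this]
        zify [show m + 1 ≤ 8 * (m + 1) ^ 2 by nlinarith]
        ring

end

/-- **Alon–Krivelevich–Sudakov.** If `F` is a bipartite `r`-degenerate graph, then
`ex(n, F) = O(n^{2 - 1/(4r)})`. -/
theorem aks_degenerate_turan (r : ℕ) (hr : 1 ≤ r) {V : Type} [Fintype V]
    (F : SimpleGraph V) (hbip : F.Colorable 2) (hdeg : Degenerate r F) :
    ∃ C : ℝ, ∀ (n : ℕ) (G : SimpleGraph (Fin n)) [DecidableRel G.Adj],
      ¬ ContainsCopy F G →
      (G.edgeFinset.card : ℝ) ≤ C * (n : ℝ) ^ (2 - 1 / (4 * (r : ℝ))) := by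
  classical
  refine ⟨2 * ((Fintype.card V : ℝ) + 1) ^ (2 * r), fun n G _ hG => ?_⟩
  have key : (∑ v, G.degree v) ^ (4 * r ^ 2) ≤
      2 * Fintype.card V ^ (2 * r) * n ^ (8 * r ^ 2 - r) := by
    convert sum_degree_pow_le_of_not_containsCopy hr hbip hdeg hG
    exact (Fintype.card_fin n).symm
  have hdegsum : G.edgeFinset.card ≤ ∑ v, G.degree v := by
    rw [G.sum_degrees_eq_twice_card_edges]
    omega
  have hpow : (G.edgeFinset.card : ℝ) ^ (4 * r ^ 2) ≤
      2 * (Fintype.card V : ℝ) ^ (2 * r) * (n : ℝ) ^ (8 * r ^ 2 - r) := by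
    exact_mod_cast (Nat.pow_le_pow_left hdegsum _).trans key
  have hr0 : (r : ℝ) ≠ 0 := by positivity
  have hN : 4 * r ^ 2 ≠ 0 := by positivity
  set K : ℝ := 2 * ((Fintype.card V : ℝ) + 1) ^ (2 * r) with hK
  have hK1 : 1 ≤ K := by
    have : (1 : ℝ) ≤ ((Fintype.card V : ℝ) + 1) ^ (2 * r) :=
      one_le_pow₀ (by simp)
    linarith
  refine le_of_pow_le_pow_left₀ hN (by positivity) (hpow.trans ?_)
  rw [mul_pow, ← Real.rpow_mul_natCast (by positivity)]
  have hexp : (2 - 1 / (4 * (r : ℝ))) * ((4 * r ^ 2 : ℕ) : ℝ) = ((8 * r ^ 2 - r : ℕ) : ℝ) := by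
    rw [Nat.cast_sub (by nlinarith)]
    push_cast
    field_simp
    ring
  rw [hexp, Real.rpow_natCast]
  gcongr
  calc 2 * (Fintype.card V : ℝ) ^ (2 * r) ≤ K := by
        rw [hK]; gcongr; linarith
    _ ≤ K ^ (4 * r ^ 2) := le_self_pow₀ hK1 hN
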